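/- arXiv:1907.09240 — 2 statements merged into one kernel-verified Lean document; each statement's English description precedes it below -/
import Mathlib

section
/- Let (u_n) be a sequence of measurable functions ℝ^N → ℝ and let u : ℝ^N → ℝ be measurable with ∫_{ℝ^N} |u|^γ < ∞. Assume: (i) there is a constant M such that ∫_{ℝ^N} |u_n|^γ ≤ M for all n; (ii) for every R > 0, ∫_{B_R} |u_n − u|^γ → 0 as n → ∞; (iii) there is α ∈ ℝ such that the function R ↦ limsup_{n→∞} ∫_{B_R^c} |u_n|^γ tends to α as R → ∞. Then limsup_{n→∞} ∫_{ℝ^N} |u_n|^γ = ∫_{ℝ^N} |u|^γ + α. -/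
open MeasureTheory Filter Metric

lemma tendsto_integral_rpow_of_sub {X : Type*} [MeasurableSpace X] {μ : Measure X}
    {γ : ℝ} (hγ : 1 ≤ γ) {u : X → ℝ} {un : ℕ → X → ℝ}
    (hu : Measurable u) (hun : ∀ n, Measurable (un n))
    (huint : Integrable (fun x => |u x| ^ γ) μ)
    (hunint : ∀ n, Integrable (fun x => |un n x| ^ γ) μ)
    (h : Tendsto (fun n => ∫ x, |un n x - u x| ^ γ ∂μ) atTop (nhds 0)) :
    Tendsto (fun n => ∫ x, |un n x| ^ γ ∂μ) atTop (nhds (∫ x, |u x| ^ γ ∂μ)) := by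
  have hγ0 : 0 < γ := by linarith
  have hp0 : ENNReal.ofReal γ ≠ 0 := by simpa using hγ0
  have hpt : ENNReal.ofReal γ ≠ ⊤ := ENNReal.ofReal_ne_top
  have hpr : (ENNReal.ofReal γ).toReal = γ := ENNReal.toReal_ofReal hγ0.le
  haveI : Fact (1 ≤ ENNReal.ofReal γ) := ⟨by simpa using hγ⟩
  have key : ∀ f : X → ℝ, Measurable f → Integrable (fun x => |f x| ^ γ) μ →
      MemLp f (ENNReal.ofReal γ) μ := by
    intro f hf hi
    rw [← integrable_norm_rpow_iff hf.aestronglyMeasurable hp0 hpt, hpr]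
    simpa only [Real.norm_eq_abs] using hi
  have hnorm : ∀ f : X → ℝ, ∀ hf : MemLp f (ENNReal.ofReal γ) μ,
      ‖hf.toLp f‖ = (∫ x, |f x| ^ γ ∂μ) ^ γ⁻¹ := by
    intro f hf
    rw [Lp.norm_toLp, hf.eLpNorm_eq_integral_rpow_norm hp0 hpt, hpr, ENNReal.toReal_ofReal]
    · simp only [Real.norm_eq_abs]
    · positivity
  have hpow : ∀ f : X → ℝ, ∀ hf : MemLp f (ENNReal.ofReal γ) μ,
      ‖hf.toLp f‖ ^ γ = ∫ x, |f x| ^ γ ∂μ := by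
    intro f hf
    rw [hnorm, Real.rpow_inv_rpow (by positivity) hγ0.ne']
  have hU := key u hu huint
  have hUn := fun n => key (un n) (hun n) (hunint n)
  have hlim : Tendsto (fun n => (hUn n).toLp (un n)) atTop (nhds (hU.toLp u)) := by
    rw [tendsto_iff_norm_sub_tendsto_zero]
    have h2 : Tendsto (fun n => (∫ x, |un n x - u x| ^ γ ∂μ) ^ γ⁻¹) atTop (nhds 0) := by
      have := h.rpow_const (p := γ⁻¹) (Or.inr (by positivity))
      rwa [Real.zero_rpow (by positivity)] at this
    refine h2.congr fun n => ?_
    rw [← MemLp.toLp_sub, hnorm]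
    rfl
  have h3 := hlim.norm.rpow_const (p := γ) (Or.inr hγ0.le)
  rw [hpow] at h3
  exact h3.congr fun n => hpow _ _

lemma limsup_add_of_tendsto {a b : ℕ → ℝ} {l : ℝ} (ha : Tendsto a atTop (nhds l))
    (h1 : IsBoundedUnder (· ≤ ·) atTop b) (h2 : IsBoundedUnder (· ≥ ·) atTop b) :
    limsup (fun n => a n + b n) atTop = l + limsup b atTop := by
  apply le_antisymm
  · have := limsup_add_le (u := a) (v := b) ha.isBoundedUnder_ge ha.isBoundedUnder_le
      h2.isCoboundedUnder_le h1
    rw [ha.limsup_eq] at this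
    exact this
  · have := le_limsup_add (u := b) (v := a) h1 h2.isCoboundedUnder_le
      ha.isBoundedUnder_le ha.isBoundedUnder_ge
    rw [ha.liminf_eq, add_comm b a, add_comm] at this
    exact this

/-- Splitting of mass at infinity: if `(u_n)` has uniformly bounded `L^γ`-mass,
`u_n → u` in `L^γ` on every ball, and the concentration-at-infinity function
`R ↦ limsup_n ∫_{‖x‖ > R} |u_n|^γ` tends to `α` as `R → ∞`, then
`limsup_n ∫ |u_n|^γ = ∫ |u|^γ + α`. -/
theorem mass_splitting_at_infinity
    (N : ℕ) (hN : 1 ≤ N) (γ : ℝ) (hγ : 1 ≤ γ)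
    (u : EuclideanSpace ℝ (Fin N) → ℝ) (un : ℕ → EuclideanSpace ℝ (Fin N) → ℝ)
    (hu : Measurable u) (hun : ∀ n, Measurable (un n))
    (huint : Integrable (fun x => |u x| ^ γ))
    (hunint : ∀ n, Integrable (fun x => |un n x| ^ γ))
    (M : ℝ) (hM : ∀ n, (∫ x, |un n x| ^ γ) ≤ M)
    (hloc : ∀ R : ℝ, 0 < R →
      Tendsto (fun n => ∫ x in closedBall (0 : EuclideanSpace ℝ (Fin N)) R,
        |un n x - u x| ^ γ) atTop (nhds 0))
    (α : ℝ)
    (hα : Tendsto (fun R : ℝ =>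
        limsup (fun n => ∫ x in (closedBall (0 : EuclideanSpace ℝ (Fin N)) R)ᶜ,
          |un n x| ^ γ) atTop) atTop (nhds α)) :
    limsup (fun n => ∫ x, |un n x| ^ γ) atTop = (∫ x, |u x| ^ γ) + α := by
  have hB : Tendsto (fun R : ℝ => ∫ x in closedBall (0 : EuclideanSpace ℝ (Fin N)) R, |u x| ^ γ)
      atTop (nhds (∫ x, |u x| ^ γ)) :=
    (aecover_closedBall tendsto_id).integral_tendsto_of_countably_generated huint
  refine tendsto_nhds_unique (tendsto_const_nhds.congr' ?_) (hB.add hα)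
  filter_upwards [Ioi_mem_atTop (0 : ℝ)] with R hR
  have ht := tendsto_integral_rpow_of_sub hγ hu hun huint.integrableOn
    (fun n => (hunint n).integrableOn) (hloc R hR)
  rw [← limsup_add_of_tendsto ht]
  · congr 1
    ext n
    exact (integral_add_compl measurableSet_closedBall (hunint n)).symm
  · refine isBoundedUnder_of ⟨M, fun n => le_trans ?_ (hM n)⟩
    exact setIntegral_le_integral (hunint n) (Eventually.of_forall fun x => by positivity)
  · exact isBoundedUnder_of ⟨0, fun n => integral_nonneg fun x => by positivity⟩
end

section
/- Let (u_n) be a sequence of measurable functions ℝ^N → ℝ and let u : ℝ^N → ℝ be measurable with ∫_{ℝ^N} |u|^γ < ∞. Let f : ℝ^N → ℝ be measurable and bounded, and suppose f(x) → f_∞ as ‖x‖ → ∞ (i.e. f tends to the real number f_∞ along the cocompact filter). Assume: (i) there is a constant M such that ∫_{ℝ^N} |u_n|^γ ≤ M for all n; (ii) for every R > 0, ∫_{B_R} |u_n − u|^γ → 0 as n → ∞; (iii) for every R > 0 the limit t(R) := lim_{n→∞} ∫_{B_R^c} |u_n|^γ exists, and t(R) → α as R → ∞ for some α ∈ ℝ.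 Then ∫_{ℝ^N} f·|u_n|^γ → ∫_{ℝ^N} f·|u|^γ + f_∞·α as n → ∞. -/
open MeasureTheory Filter Metric

lemma aux_conv (γ : ℝ) (hγ : 1 ≤ γ) (s : ℝ) (h0 : 0 < s) (h1 : s < 1) (a b : ℝ)
    (ha : 0 ≤ a) (hb : 0 ≤ b) :
    (a + b) ^ γ ≤ (1 - s) ^ (1 - γ) * a ^ γ + s ^ (1 - γ) * b ^ γ := by
  have h1' : 0 < 1 - s := by linarith
  have := (convexOn_rpow hγ).2 (x := a / (1 - s)) (y := b / s)
    (Set.mem_Ici.2 (by positivity)) (Set.mem_Ici.2 (by positivity)) h1'.le h0.le (by ring)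
  simp only [smul_eq_mul] at this
  rw [mul_div_cancel₀ _ h1'.ne', mul_div_cancel₀ _ h0.ne', Real.div_rpow ha h1'.le,
    Real.div_rpow hb h0.le] at this
  rw [Real.rpow_sub h1', Real.rpow_sub h0, Real.rpow_one, Real.rpow_one]
  refine this.trans (le_of_eq ?_)
  ring

lemma aux_ineq (γ : ℝ) (hγ : 1 ≤ γ) (ε : ℝ) (hε : 0 < ε) :
    ∃ C : ℝ, 0 ≤ C ∧ ∀ x y : ℝ,
      |(|x| ^ γ - |y| ^ γ)| ≤ ε * (|x| ^ γ + |y| ^ γ) + C * |x - y| ^ γ := by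
  have hc : Tendsto (fun s : ℝ => (1 - s) ^ (1 - γ)) (nhdsWithin 0 (Set.Ioi 0)) (nhds 1) := by
    have : ContinuousAt (fun s : ℝ => (1 - s) ^ (1 - γ)) 0 :=
      ContinuousAt.rpow_const (by fun_prop) (Or.inl (by norm_num))
    have h := this.tendsto
    simp only [sub_zero, Real.one_rpow] at h
    exact h.mono_left nhdsWithin_le_nhds
  have e1 := hc.eventually (gt_mem_nhds (show (1:ℝ) < 1 + ε by linarith))
  have e2 : ∀ᶠ s : ℝ in nhdsWithin 0 (Set.Ioi 0), s ∈ Set.Ioo (0:ℝ) 1 :=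
    Ioo_mem_nhdsGT (by norm_num)
  obtain ⟨s, hs, h0, h1⟩ := (e1.and e2).exists
  refine ⟨s ^ (1 - γ), by positivity, ?_⟩
  have key : ∀ x y : ℝ, |x| ^ γ - |y| ^ γ ≤ ε * |y| ^ γ + s ^ (1 - γ) * |x - y| ^ γ := by
    intro x y
    have h := aux_conv γ hγ s h0 h1 |y| |x - y| (abs_nonneg _) (abs_nonneg _)
    have h2 : |x| ^ γ ≤ (|y| + |x - y|) ^ γ := by
      apply Real.rpow_le_rpow (abs_nonneg _) _ (by linarith)
      have := abs_add_le y (x - y)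
      simpa using this
    have h3 : 0 ≤ |y| ^ γ := by positivity
    nlinarith
  intro x y
  have k1 := key x y
  have k2 := key y x
  rw [abs_sub_comm y x] at k2
  have h3 : 0 ≤ ε * |y| ^ γ := by positivity
  have h4 : 0 ≤ ε * |x| ^ γ := by positivity
  rw [abs_le]
  constructor <;> linarith

lemma aux_integrable {E : Type*} [MeasurableSpace E] (μ : Measure E) (γ : ℝ) (hγ : 1 ≤ γ)
    (u v : E → ℝ) (hu : Measurable u) (hv : Measurable v)
    (hui : Integrable (fun x => |u x| ^ γ) μ) (hvi : Integrable (fun x => |v x| ^ γ) μ) :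
    Integrable (fun x => |v x - u x| ^ γ) μ := by
  refine Integrable.mono' ((hvi.const_mul ((1 - (1/2:ℝ)) ^ (1 - γ))).add
    (hui.const_mul ((1/2:ℝ) ^ (1 - γ))))
    (Measurable.aestronglyMeasurable (by measurability)) (Eventually.of_forall fun x => ?_)
  rw [Real.norm_of_nonneg (by positivity)]
  refine le_trans ?_ (aux_conv γ hγ (1/2) (by norm_num) (by norm_num) |v x| |u x|
    (abs_nonneg _) (abs_nonneg _))
  exact Real.rpow_le_rpow (abs_nonneg _) (abs_sub _ _) (by linarith)

lemma aux_local {E : Type*} [MeasurableSpace E] (μ : Measure E) (γ : ℝ) (hγ : 1 ≤ γ)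
    (u : E → ℝ) (un : ℕ → E → ℝ) (hu : Measurable u) (hun : ∀ n, Measurable (un n))
    (hui : Integrable (fun x => |u x| ^ γ) μ) (hvi : ∀ n, Integrable (fun x => |un n x| ^ γ) μ)
    (M : ℝ) (hM : ∀ n, (∫ x, |un n x| ^ γ ∂μ) ≤ M) 
    (hloc : Tendsto (fun n => ∫ x, |un n x - u x| ^ γ ∂μ) atTop (nhds 0)) :
    Tendsto (fun n => ∫ x, |(|un n x| ^ γ - |u x| ^ γ)| ∂μ) atTop (nhds 0) := by
  have hU : 0 ≤ ∫ x, |u x| ^ γ ∂μ := integral_nonneg fun x => by positivity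
  have hM0 : 0 ≤ M := (integral_nonneg fun x => by positivity).trans (hM 0)
  set U := ∫ x, |u x| ^ γ ∂μ with hUdef
  rw [Metric.tendsto_atTop]
  intro δ hδ
  obtain ⟨C, hC, hineq⟩ := aux_ineq γ hγ (δ / (2 * (M + U + 1))) (by positivity)
  have h2 : Tendsto (fun n => C * ∫ x, |un n x - u x| ^ γ ∂μ) atTop (nhds 0) := by
    simpa using hloc.const_mul C
  obtain ⟨n0, hn0⟩ := eventually_atTop.1 (h2.eventually (gt_mem_nhds (half_pos hδ)))
  refine ⟨n0, fun n hn => ?_⟩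
  rw [Real.dist_0_eq_abs, abs_of_nonneg (integral_nonneg fun x => abs_nonneg _)]
  have hw := aux_integrable μ γ hγ u (un n) hu (hun n) hui (hvi n)
  have h3 := integral_mono (μ := μ) ((hvi n).sub hui).abs
    ((((hvi n).add hui).const_mul (δ / (2 * (M + U + 1)))).add (hw.const_mul C))
    (fun x => hineq (un n x) (u x))
  have h4 : (∫ x, (δ / (2 * (M + U + 1)) * (|un n x| ^ γ + |u x| ^ γ)
      + C * |un n x - u x| ^ γ) ∂μ) = δ / (2 * (M + U + 1)) * ((∫ x, |un n x| ^ γ ∂μ) + U)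
      + C * ∫ x, |un n x - u x| ^ γ ∂μ := by
    have hs : Integrable (fun x => |un n x| ^ γ + |u x| ^ γ) μ := (hvi n).add hui
    rw [integral_add (hs.const_mul _) (hw.const_mul C), integral_const_mul,
      integral_const_mul, integral_add (hvi n) hui]
  have h5 : δ / (2 * (M + U + 1)) * ((∫ x, |un n x| ^ γ ∂μ) + U) ≤ δ / 2 := by
    calc _ ≤ δ / (2 * (M + U + 1)) * (M + U + 1) := by
          gcongr ?_ * ?_
          linarith [hM n]
      _ = δ / 2 := by field_simp
  have h6 := hn0 n hn
  refine lt_of_le_of_lt (h3.trans (le_of_eq h4)) ?_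
  linarith

/-- Weighted splitting identity at infinity: if `(u_n)` has uniformly bounded
`L^γ`-mass, `u_n → u` in `L^γ` on every ball, for every `R > 0` the mass
`∫_{‖x‖ > R} |u_n|^γ` converges to some `t(R)` with `t(R) → α` as `R → ∞`,
and the bounded measurable weight `f` tends to `f_∞` at infinity, then
`∫ f |u_n|^γ → ∫ f |u|^γ + f_∞ α`. -/
theorem weighted_mass_splitting_at_infinity
    (N : ℕ) (hN : 1 ≤ N) (γ : ℝ) (hγ : 1 ≤ γ)
    (u : EuclideanSpace ℝ (Fin N) → ℝ) (un : ℕ → EuclideanSpace ℝ (Fin N) → ℝ)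
    (hu : Measurable u) (hun : ∀ n, Measurable (un n))
    (huint : Integrable (fun x => |u x| ^ γ))
    (hunint : ∀ n, Integrable (fun x => |un n x| ^ γ))
    (f : EuclideanSpace ℝ (Fin N) → ℝ) (hf : Measurable f)
    (hfb : ∃ C : ℝ, ∀ x, |f x| ≤ C)
    (finf : ℝ) (hfinf : Tendsto f (cocompact (EuclideanSpace ℝ (Fin N))) (nhds finf))
    (M : ℝ) (hM : ∀ n, (∫ x, |un n x| ^ γ) ≤ M)
    (hloc : ∀ R : ℝ, 0 < R →
      Tendsto (fun n => ∫ x in closedBall (0 : EuclideanSpace ℝ (Fin N)) R,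
        |un n x - u x| ^ γ) atTop (nhds 0))
    (t : ℝ → ℝ)
    (ht : ∀ R : ℝ, 0 < R →
      Tendsto (fun n => ∫ x in (closedBall (0 : EuclideanSpace ℝ (Fin N)) R)ᶜ,
        |un n x| ^ γ) atTop (nhds (t R)))
    (α : ℝ) (htα : Tendsto t atTop (nhds α)) :
    Tendsto (fun n => ∫ x, f x * |un n x| ^ γ) atTop
      (nhds ((∫ x, f x * |u x| ^ γ) + finf * α)) := by
  obtain ⟨C, hC⟩ := hfb
  have hC0 : 0 ≤ C := (abs_nonneg _).trans (hC 0)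
  have hM0 : 0 ≤ M := (integral_nonneg fun x => by positivity).trans (hM 0)
  have hfi : ∀ g : EuclideanSpace ℝ (Fin N) → ℝ, Integrable g → Integrable (fun x => f x * g x) :=
    fun g hg => hg.bdd_mul hf.aestronglyMeasurable (Eventually.of_forall hC)
  have htail : Tendsto (fun R : ℝ => ∫ x in (closedBall (0 : EuclideanSpace ℝ (Fin N)) R)ᶜ,
      |u x| ^ γ) atTop (nhds 0) := by
    have h := (aecover_closedBall (μ := (volume : Measure (EuclideanSpace ℝ (Fin N))))
      (x := 0) tendsto_id).integral_tendsto_of_countably_generated huint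
    have h' := h.const_sub (∫ x, |u x| ^ γ)
    rw [sub_self] at h'
    refine h'.congr fun R => ?_
    rw [← integral_add_compl (measurableSet_closedBall (x := 0) (ε := R)) huint]
    simp
  rw [Metric.tendsto_atTop]
  intro δ hδ
  set ε := δ / (2 * (M + |finf| + C + 1)) with hε
  have hε0 : 0 < ε := by positivity
  have hεb : ε * (M + |finf| + C) < δ / 2 := by
    have : ε * (M + |finf| + C + 1) = δ / 2 := by rw [hε]; field_simp
    linarith
  have e1 : ∀ᶠ R : ℝ in atTop, ∀ x ∈ (closedBall (0 : EuclideanSpace ℝ (Fin N)) R)ᶜ,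
      |f x - finf| ≤ ε := by
    have := hfinf.eventually (Metric.closedBall_mem_nhds finf hε0)
    obtain ⟨K, hK, hKs⟩ := mem_cocompact.1 this
    obtain ⟨r, hr⟩ := hK.isBounded.subset_closedBall 0
    filter_upwards [eventually_ge_atTop r] with R hR x hx
    have : x ∈ Kᶜ := fun h => hx (closedBall_subset_closedBall hR (hr h))
    exact hKs this
  have e2 := htα.eventually (Metric.ball_mem_nhds α hε0)
  have e3 := htail.eventually (gt_mem_nhds hε0)
  obtain ⟨R, h1, h2, h3, hR⟩ := (e1.and (e2.and (e3.and (eventually_gt_atTop 0)))).exists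
  rw [Real.dist_eq] at h2
  set B := closedBall (0 : EuclideanSpace ℝ (Fin N)) R with hB
  have hBm : MeasurableSet B := measurableSet_closedBall
  have hl := aux_local (volume.restrict B) γ hγ u un hu hun huint.integrableOn
    (fun n => (hunint n).integrableOn) M
    (fun n => (setIntegral_le_integral (hunint n)
      (Eventually.of_forall fun x => by positivity)).trans (hM n)) (hloc R hR)
  have hlim : Tendsto (fun n => C * (∫ x in B, |(|un n x| ^ γ - |u x| ^ γ)|)
      + |finf| * |(∫ x in Bᶜ, |un n x| ^ γ) - t R|) atTop (nhds 0) := by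
    have := (hl.const_mul C).add ((((ht R hR).sub_const (t R)).abs).const_mul |finf|)
    simpa using this
  obtain ⟨n0, hn0⟩ := eventually_atTop.1 (hlim.eventually (gt_mem_nhds (half_pos hδ)))
  refine ⟨n0, fun n hn => ?_⟩
  have h4 := hn0 n hn
  have ha := hunint n
  have hfa := hfi _ ha
  have hfu := hfi _ huint
  have d1 : |∫ x in B, f x * (|un n x| ^ γ - |u x| ^ γ)|
      ≤ C * ∫ x in B, |(|un n x| ^ γ - |u x| ^ γ)| := by
    rw [← integral_const_mul, ← Real.norm_eq_abs]
    refine norm_integral_le_of_norm_le ((ha.sub huint).abs.const_mul C).integrableOn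
      (Eventually.of_forall fun x => ?_)
    rw [Real.norm_eq_abs, abs_mul]
    exact mul_le_mul_of_nonneg_right (hC x) (abs_nonneg _)
  have d2 : |∫ x in Bᶜ, (f x - finf) * |un n x| ^ γ| ≤ ε * M := by
    have : |∫ x in Bᶜ, (f x - finf) * |un n x| ^ γ| ≤ ∫ x in Bᶜ, ε * |un n x| ^ γ := by
      rw [← Real.norm_eq_abs]
      refine norm_integral_le_of_norm_le (ha.const_mul ε).integrableOn
        ((ae_restrict_iff' hBm.compl).2 (Eventually.of_forall fun x hx => ?_))
      rw [Real.norm_eq_abs, abs_mul, abs_of_nonneg (a := |un n x| ^ γ) (by positivity)]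
      exact mul_le_mul_of_nonneg_right (h1 x hx) (by positivity)
    rw [integral_const_mul] at this
    refine this.trans (mul_le_mul_of_nonneg_left ?_ hε0.le)
    exact (setIntegral_le_integral ha (Eventually.of_forall fun x => by positivity)).trans (hM n)
  have d3 : |∫ x in Bᶜ, f x * |u x| ^ γ| ≤ C * ε := by
    have : |∫ x in Bᶜ, f x * |u x| ^ γ| ≤ ∫ x in Bᶜ, C * |u x| ^ γ := by
      rw [← Real.norm_eq_abs]
      refine norm_integral_le_of_norm_le (huint.const_mul C).integrableOn
        (Eventually.of_forall fun x => ?_)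
      rw [Real.norm_eq_abs, abs_mul, abs_of_nonneg (a := |u x| ^ γ) (by positivity)]
      exact mul_le_mul_of_nonneg_right (hC x) (by positivity)
    rw [integral_const_mul] at this
    exact this.trans (mul_le_mul_of_nonneg_left h3.le hC0)
  have s1 : ∫ x in B, f x * (|un n x| ^ γ - |u x| ^ γ)
      = (∫ x in B, f x * |un n x| ^ γ) - ∫ x in B, f x * |u x| ^ γ := by
    rw [← integral_sub hfa.integrableOn hfu.integrableOn]
    simp only [mul_sub]
  have s2 : ∫ x in Bᶜ, (f x - finf) * |un n x| ^ γ
      = (∫ x in Bᶜ, f x * |un n x| ^ γ) - finf * ∫ x in Bᶜ, |un n x| ^ γ := by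
    rw [← integral_const_mul, ← integral_sub hfa.integrableOn (ha.const_mul finf).integrableOn]
    simp only [sub_mul]
  have s3 := integral_add_compl hBm hfa
  have s4 := integral_add_compl hBm hfu
  have hdec : (∫ x, f x * |un n x| ^ γ) - ((∫ x, f x * |u x| ^ γ) + finf * α)
      = (∫ x in B, f x * (|un n x| ^ γ - |u x| ^ γ))
      + (∫ x in Bᶜ, (f x - finf) * |un n x| ^ γ)
      + finf * ((∫ x in Bᶜ, |un n x| ^ γ) - t R) + finf * (t R - α)
      - ∫ x in Bᶜ, f x * |u x| ^ γ := by
    rw [s1, s2, ← s3, ← s4]; ring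
  rw [Real.dist_eq, hdec]
  have d4 : |finf * (t R - α)| ≤ |finf| * ε := by
    rw [abs_mul]; exact mul_le_mul_of_nonneg_left h2.le (abs_nonneg _)
  have d5 := abs_mul finf ((∫ x in Bᶜ, |un n x| ^ γ) - t R)
  refine lt_of_le_of_lt ((abs_sub _ _).trans (add_le_add_left ((abs_add_le _ _).trans
    (add_le_add_left ((abs_add_le _ _).trans (add_le_add_left (abs_add_le _ _) _)) _)) _)) ?_
  linarith
end
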